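/- Let S ⊆ G_d with 𝟏 ∉ S, and suppose that both p(S) and p(S ∪ {𝟏}) are vertices of the White Whale H_∞^+(d,1). Then |S| = 2^{d−1} − 1 (so any edge of the White Whale that coincides, up to translation, with the segment from the origin to 𝟏 connects a vertex that is the sum of exactly 2^{d−1} − 1 generators to a vertex that is the sum of exactly 2^{d−1} generators). -/

import Mathlib

/-- The set `G_d` of generators of the White Whale:
all nonzero 0/1-valued vectors of `ℝ^d`. -/
def whaleGens (d : ℕ) : Set (Fin d → ℝ) :=
  {g | g ≠ 0 ∧ ∀ i, g i = 0 ∨ g i = 1}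

/-- The point `p(S)`: the sum of the vectors in `S` (with `p(∅) = 0`). -/
noncomputable def whaleSum {d : ℕ} (S : Set (Fin d → ℝ)) : Fin d → ℝ :=
  ∑ᶠ g ∈ S, g

/-- The White Whale `H_∞^+(d,1)`: the convex hull of the points `p(S)`
over all subsets `S ⊆ G_d`. -/
noncomputable def whiteWhale (d : ℕ) : Set (Fin d → ℝ) :=
  convexHull ℝ {x | ∃ S : Set (Fin d → ℝ), S ⊆ whaleGens d ∧ x = whaleSum S}

/-- A vertex of the White Whale is an extreme point of it. -/
def IsWhaleVertex (d : ℕ) (x : Fin d → ℝ) : Prop :=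
  x ∈ Set.extremePoints ℝ (whiteWhale d)

/-- The set of all 0/1-valued vectors of `ℝ^d` has `2 ^ d` elements. -/
theorem ncard_zeroOne_vectors (d : ℕ) :
    {g : Fin d → ℝ | ∀ i, g i = 0 ∨ g i = 1}.ncard = 2 ^ d := by
  classical
  have h : {g : Fin d → ℝ | ∀ i, g i = 0 ∨ g i = 1} =
      ↑(Fintype.piFinset fun _ : Fin d => ({0, 1} : Finset ℝ)) := by
    ext g
    simp
  rw [h, Set.ncard_coe_finset, Fintype.card_piFinset]
  simp

theorem finite_whaleGens (d : ℕ) : (whaleGens d).Finite :=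
  (Set.finite_of_ncard_ne_zero ((ncard_zeroOne_vectors d).trans_ne (by positivity))).subset
    fun _ hg => hg.2

theorem whaleSum_insert {d : ℕ} {S : Set (Fin d → ℝ)} (hS : S.Finite) {g : Fin d → ℝ}
    (hg : g ∉ S) : whaleSum (insert g S) = g + whaleSum S :=
  finsum_mem_insert _ hg hS

theorem whaleSum_mem_whiteWhale {d : ℕ} {S : Set (Fin d → ℝ)} (hS : S ⊆ whaleGens d) :
    whaleSum S ∈ whiteWhale d :=
  subset_convexHull ℝ _ ⟨S, hS, rfl⟩

/-- A vertex is not the midpoint of two distinct points of the White Whale. -/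
theorem IsWhaleVertex.eq_of_add_eq {d : ℕ} {x y z : Fin d → ℝ} (hx : IsWhaleVertex d x)
    (hy : y ∈ whiteWhale d) (hz : z ∈ whiteWhale d) (h : y + z = x + x) : y = x := by
  refine (mem_extremePoints.mp hx).2 y hy z hz ?_ |>.1
  refine ⟨1 / 2, 1 / 2, by norm_num, by norm_num, by norm_num, ?_⟩
  rw [← smul_add, h, ← two_smul ℝ x, smul_smul]
  norm_num

theorem allOnes_sub_mem_whaleGens {d : ℕ} {g : Fin d → ℝ} (hg : g ∈ whaleGens d)
    (hg1 : g ≠ fun _ => 1) : (fun _ => 1) - g ∈ whaleGens d := by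
  refine ⟨fun h => hg1 (sub_eq_zero.mp h).symm, fun i => ?_⟩
  rcases hg.2 i with h | h <;> simp [h]

theorem allOnes_sub_ne_self {d : ℕ} {g : Fin d → ℝ} (hg : g ∈ whaleGens d) :
    (fun _ => 1) - g ≠ g := by
  intro h
  obtain ⟨i, -⟩ := Function.ne_iff.mp hg.1
  have hi := congrFun h i
  rcases hg.2 i with h0 | h0 <;> simp [h0] at hi

/-- If `R` contains neither `𝟏` nor either of two complementary generators, then `𝟏 + p(R)` is
not a vertex. -/
theorem not_isWhaleVertex_allOnes_add {d : ℕ} {R : Set (Fin d → ℝ)} (hR : R ⊆ whaleGens d)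
    {g : Fin d → ℝ} (hg : g ∈ whaleGens d) (hg1 : g ≠ fun _ => 1)
    (h1R : (fun _ => 1) ∉ R) (hgR : g ∉ R) (hcR : (fun _ => 1) - g ∉ R) :
    ¬ IsWhaleVertex d ((fun _ => 1) + whaleSum R) := by
  intro hv
  have hfin : R.Finite := (finite_whaleGens d).subset hR
  have hone : (fun _ => 1) ∈ whaleGens d :=
    ⟨fun h => hg.1 (funext fun i => absurd (congrFun h i) one_ne_zero), fun _ => Or.inr rfl⟩
  have hA := whaleSum_insert hfin hcR
  have hB : whaleSum (insert (fun _ => 1) (insert g R)) = (fun _ => 1) + (g + whaleSum R) := by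
    rw [whaleSum_insert (hfin.insert g), whaleSum_insert hfin hgR]
    rintro (h | h)
    exacts [hg1 h.symm, h1R h]
  have key := hv.eq_of_add_eq
    (whaleSum_mem_whiteWhale (Set.insert_subset (allOnes_sub_mem_whaleGens hg hg1) hR))
    (whaleSum_mem_whiteWhale (Set.insert_subset hone (Set.insert_subset hg hR)))
    (by rw [hA, hB]; abel)
  rw [hA] at key
  exact hg.1 (by simpa using key)

/-- If 𝟏 ∉ S and both p(S) and p(S ∪ {𝟏}) are vertices of the White Whale,
then |S| = 2^(d−1) − 1. -/
theorem whale_edge_allOnes (d : ℕ) (hd : 1 ≤ d)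
    (S : Set (Fin d → ℝ)) (hS : S ⊆ whaleGens d)
    (h1 : (fun _ : Fin d => (1 : ℝ)) ∉ S)
    (hv : IsWhaleVertex d (whaleSum S))
    (hv1 : IsWhaleVertex d (whaleSum (S ∪ {fun _ : Fin d => (1 : ℝ)}))) :
    S.ncard = 2 ^ (d - 1) - 1 := by
  have hfin : S.Finite := (finite_whaleGens d).subset hS
  set e : Fin d → ℝ := fun _ => 1 with he
  have he0 : e ≠ 0 := fun h => one_ne_zero (congrFun h ⟨0, hd⟩)
  have hne_one : ∀ g ∈ S, g ≠ e := fun g hg h => h1 (h ▸ hg)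
  have hnot_both : ∀ g ∈ S, e - g ∉ S := by
    intro g hg hc
    have hne : e - g ≠ g := allOnes_sub_ne_self (hS hg)
    have hR : S \ {g, e - g} ⊆ whaleGens d := Set.sdiff_subset.trans hS
    refine not_isWhaleVertex_allOnes_add hR (hS hg) (hne_one g hg)
      (fun h => h1 h.1) (by simp) (by simp [he]) ?_
    have hS' : S = insert g (insert (e - g) (S \ {g, e - g})) := by
      ext x
      by_cases hx : x = g <;> by_cases hx' : x = e - g <;> simp_all
    have hsum : whaleSum S = e + whaleSum (S \ {g, e - g}) := by
      conv_lhs => rw [hS']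
      rw [whaleSum_insert (hfin.sdiff.insert _) (by simp [hne.symm]),
        whaleSum_insert hfin.sdiff (by simp)]
      abel
    exact hsum ▸ hv
  have hone_of : ∀ g ∈ whaleGens d, g ≠ e → g ∉ S → e - g ∈ S := by
    intro g hg hg1 hgS
    by_contra hc
    refine not_isWhaleVertex_allOnes_add hS hg hg1 h1 hgS hc ?_
    rwa [Set.union_singleton, whaleSum_insert hfin h1] at hv1
  have hcompl : ((e - ·) '' S).ncard = S.ncard :=
    Set.ncard_image_of_injective _ sub_right_injective
  have hcube : {g : Fin d → ℝ | ∀ i, g i = 0 ∨ g i = 1} =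
      (S ∪ (e - ·) '' S) ∪ {0, e} := by
    ext g
    constructor
    · intro hg
      by_cases h0 : g = 0
      · simp [h0]
      by_cases hge : g = e
      · simp [hge]
      by_cases hgS : g ∈ S
      · exact Or.inl (Or.inl hgS)
      · exact Or.inl (Or.inr ⟨e - g, hone_of g ⟨h0, hg⟩ hge hgS, sub_sub_cancel _ _⟩)
    · rintro ((hg | ⟨g, hg, rfl⟩) | rfl | rfl)
      · exact (hS hg).2
      · exact (allOnes_sub_mem_whaleGens (hS hg) (hne_one g hg)).2
      · exact fun _ => Or.inl rfl
      · exact fun _ => Or.inr rfl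
  have hdisj : Disjoint S ((e - ·) '' S) := by
    rw [Set.disjoint_left]
    rintro _ hx ⟨g, hg, rfl⟩
    exact hnot_both g hg hx
  have hdisj' : Disjoint (S ∪ (e - ·) '' S) {0, e} := by
    rw [Set.disjoint_left]
    rintro _ (hx | ⟨g, hg, rfl⟩) (h | h)
    · exact (hS hx).1 h
    · exact h1 (h ▸ hx)
    · exact h1 ((sub_eq_zero.mp h) ▸ hg)
    · exact (hS hg).1 (sub_eq_self.mp h)
  have hcard := ncard_zeroOne_vectors d
  rw [hcube, Set.ncard_union_eq hdisj' (hfin.union (hfin.image _)),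
    Set.ncard_union_eq hdisj hfin (hfin.image _), hcompl, Set.ncard_pair he0.symm] at hcard
  obtain ⟨k, rfl⟩ := Nat.exists_eq_add_of_le' hd
  rw [pow_succ] at hcard
  simp only [Nat.add_sub_cancel]
  omega
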